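/- Every graph G with e(G) > (k−2)|V(G)|/2 contains every tree of order k and diameter at most 4 as a subgraph. -/

import Mathlib

open Finset SimpleGraph
open scoped Classical

/-- Spectral radius (largest adjacency eigenvalue) of a finite simple graph. -/
noncomputable def specRad {V : Type*} [Finite V] (G : SimpleGraph V) : ℝ :=
  letI := Fintype.ofFinite V
  letI := Classical.decEq V
  letI : DecidableRel G.Adj := Classical.decRel _
  ⨆ i, (Matrix.IsHermitian.eigenvalues
    (A := G.adjMatrix ℝ)
    (by rw [Matrix.IsHermitian, Matrix.conjTranspose_eq_transpose_of_trivial]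
        exact G.isSymm_adjMatrix)) i

/-- `S_{n,k} = K_k ∨ (n-k)·K_1` : the first `k` vertices are adjacent to everything. -/
def Snk (n k : ℕ) : SimpleGraph (Fin n) :=
  SimpleGraph.fromRel (fun i _ => (i : ℕ) < k)

/-- `G` contains a copy of `H` (a subgraph isomorphic to `H`). -/
def Contains {α β : Type*} (G : SimpleGraph α) (H : SimpleGraph β) : Prop :=
  ∃ f : H →g G, Function.Injective f

/-- Number of edges of a finite graph. -/
noncomputable def ecount {V : Type*} [Fintype V] (G : SimpleGraph V) : ℕ :=
  G.edgeFinset.card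

/-- In a finite tree of diameter at most four, some vertex is within distance two of all others. -/
lemma SimpleGraph.IsTree.exists_forall_dist_le_two {W : Type*} [Fintype W] {T : SimpleGraph W}
    (hT : T.IsTree) (hdiam : ∀ v w : W, T.dist v w ≤ 4) : ∃ c, ∀ w, T.dist c w ≤ 2 := by
  have hconn := hT.connected
  have := hconn.nonempty
  obtain ⟨c, -, hc⟩ := Finset.exists_min_image (univ : Finset W)
    (fun c => univ.sup (fun w => T.dist c w)) univ_nonempty
  refine ⟨c, ?_⟩
  by_contra! hfar
  obtain ⟨z, -, hz⟩ := Finset.exists_mem_eq_sup (univ : Finset W) univ_nonempty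
    (fun w => T.dist c w)
  have hmax : ∀ w, T.dist c w ≤ T.dist c z := fun w =>
    hz ▸ Finset.le_sup (f := fun w => T.dist c w) (mem_univ w)
  have hz3 : 3 ≤ T.dist c z := by
    obtain ⟨w, hw⟩ := hfar
    have := hmax w
    omega
  obtain ⟨p, hp⟩ := hconn.exists_walk_length_eq_dist c z
  cases p with
  | nil => simp at hz3
  | @cons _ c' _ hadj q =>
    rw [Walk.length_cons] at hp
    have hq : q.length = T.dist c' z := by
      have h1 := T.dist_le q
      have h2 := hconn.dist_triangle (u := c) (v := c') (w := z)
      rw [dist_eq_one_iff_adj.2 hadj] at h2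
      omega
    obtain ⟨z', -, hz'⟩ := Finset.exists_mem_eq_sup (univ : Finset W) univ_nonempty
      (fun w => T.dist c' w)
    have hz'max := hc c' (mem_univ _)
    rw [hz, hz'] at hz'max
    have h3 := hT.dist_eq_dist_add_one_of_adj z' hadj
    rw [dist_comm (u := z') (v := c), dist_comm (u := z') (v := c')] at h3
    have h4 := hmax z'
    have h5 : T.dist c' z' = T.dist c z' + 1 := by omega
    obtain ⟨p', hp'⟩ := hconn.exists_walk_length_eq_dist z' c
    have hpath : (p'.append (Walk.cons hadj q)).IsPath := by
      have hP : p'.IsPath := p'.isPath_of_length_eq_dist hp'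
      have hQ : (Walk.cons hadj q).IsPath :=
        Walk.isPath_of_length_eq_dist _ (by rw [Walk.length_cons]; exact hp)
      have hdis : ∀ w, w ∈ p'.support → w ∉ q.support := by
        intro w hw hw'
        have e1 := congrArg Walk.length (p'.take_spec hw)
        have e2 := congrArg Walk.length (q.take_spec hw')
        rw [Walk.length_append] at e1 e2
        have a1 := T.dist_le (p'.takeUntil w hw)
        have a2 := T.dist_le (p'.dropUntil w hw)
        have a3 := T.dist_le (q.takeUntil w hw')
        have a4 := T.dist_le (q.dropUntil w hw')
        have b1 := hconn.dist_triangle (u := z') (v := w) (w := c')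
        have b2 := hconn.dist_triangle (u := c) (v := w) (w := z)
        rw [dist_comm (u := z') (v := c')] at b1
        rw [dist_comm (u := z') (v := c)] at hp'
        rw [dist_comm (u := w) (v := c')] at b1
        rw [dist_comm (u := w) (v := c)] at a2
        omega
      rw [Walk.isPath_def, Walk.support_append, Walk.support_cons, List.tail_cons]
      exact List.nodup_append.2 ⟨hP.support_nodup, hQ.of_cons.support_nodup,
        fun a ha b hb hab => hdis a ha (hab ▸ hb)⟩
    obtain ⟨r, hr, hrl⟩ := hconn.exists_path_of_dist z' z
    have heq := (hT.isAcyclic.subsingleton_path z' z).elim ⟨_, hpath⟩ ⟨r, hr⟩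
    have hlen := congrArg (fun x : T.Path z' z => x.1.length) heq
    simp only [Walk.length_append, Walk.length_cons] at hlen
    rw [dist_comm] at hp'
    have := hdiam z' z
    omega

/-- The graph `T` is a rooted tree of depth at most two: the root `c` is joined to `C`, and each
vertex `x` of `L` is joined to its parent `π x ∈ C`. -/
structure IsDepthTwoTree {W : Type*} [Fintype W] (T : SimpleGraph W) (c : W) (C L : Finset W)
    (π : W → W) : Prop where
  root_notMem_children : c ∉ C
  root_notMem_leaves : c ∉ L
  disjoint : Disjoint C L
  eq_root_or_mem : ∀ x, x = c ∨ x ∈ C ∨ x ∈ L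
  parent_mem : ∀ x ∈ L, π x ∈ C
  adj : ∀ x y, T.Adj x y →
    (x = c ∧ y ∈ C) ∨ (y = c ∧ x ∈ C) ∨ (x ∈ L ∧ y = π x) ∨ (y ∈ L ∧ x = π y)

lemma SimpleGraph.IsTree.exists_isDepthTwoTree {W : Type*} [Fintype W] {T : SimpleGraph W}
    (hT : T.IsTree) (hdiam : ∀ v w : W, T.dist v w ≤ 4) :
    ∃ c C L π, IsDepthTwoTree T c C L π := by
  obtain ⟨c, hc⟩ := hT.exists_forall_dist_le_two hdiam
  have hconn := hT.connected
  have hpar : ∀ x, ∃ y, T.dist c x = 2 → T.dist c y = 1 ∧ T.Adj y x := by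
    intro x
    by_cases hx : T.dist c x = 2
    · obtain ⟨p, hp⟩ := hconn.exists_walk_length_eq_dist c x
      rw [hx] at hp
      match p, hp with
      | .cons h (.cons h' .nil), _ => exact ⟨_, fun _ => ⟨dist_eq_one_iff_adj.2 h, h'⟩⟩
    · exact ⟨x, fun h => absurd h hx⟩
  choose π hπ using hpar
  have huniq : ∀ x y, T.dist c x = 1 → T.dist c y = 2 → T.Adj x y → x = π y := by
    intro x y hx hy hxy
    obtain ⟨h1, h2⟩ := hπ y hy
    have hcy : c ≠ y := by rintro rfl; simp at hy
    rw [dist_eq_one_iff_adj] at hx h1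
    have p1 : (Walk.cons hx (Walk.cons hxy Walk.nil)).IsPath := by
      simp [Walk.isPath_def, hx.ne, hxy.ne, hcy]
    have p2 : (Walk.cons h1 (Walk.cons h2 Walk.nil)).IsPath := by
      simp [Walk.isPath_def, h1.ne, h2.ne, hcy]
    have heq := (hT.isAcyclic.subsingleton_path c y).elim ⟨_, p1⟩ ⟨_, p2⟩
    have := congrArg (fun x : T.Path c y => x.1.support) heq
    simpa using this
  have hdown : ∀ x y, T.Adj x y → T.dist c y = T.dist c x + 1 →
      (x = c ∧ T.dist c y = 1) ∨ (T.dist c y = 2 ∧ x = π y) := by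
    intro x y hxy h
    have := hc y
    rcases Nat.eq_zero_or_pos (T.dist c x) with h0 | h0
    · exact Or.inl ⟨(hconn.dist_eq_zero_iff.1 h0).symm, by omega⟩
    · exact Or.inr ⟨by omega, huniq x y (by omega) (by omega) hxy⟩
  refine ⟨c, univ.filter (fun x => T.dist c x = 1), univ.filter (fun x => T.dist c x = 2), π,
    by simp, by simp, ?_, ?_, ?_, ?_⟩
  · rw [Finset.disjoint_left]
    intro x
    simp only [mem_filter, mem_univ, true_and]
    omega
  · intro x
    simp only [mem_filter, mem_univ, true_and]
    have := hc x
    rcases Nat.eq_zero_or_pos (T.dist c x) with h0 | h0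
    · exact Or.inl (hconn.dist_eq_zero_iff.1 h0).symm
    · omega
  · intro x hx
    simp only [mem_filter, mem_univ, true_and] at hx ⊢
    exact (hπ x hx).1
  · intro x y hxy
    simp only [mem_filter, mem_univ, true_and]
    rcases hT.dist_eq_dist_add_one_of_adj c hxy with h | h
    · have := hdown y x hxy.symm h
      tauto
    · have := hdown x y hxy h
      tauto

lemma IsDepthTwoTree.card_eq {W : Type*} [Fintype W] {T : SimpleGraph W} {c : W}
    {C L : Finset W} {π : W → W} (hT : IsDepthTwoTree T c C L π) :
    Fintype.card W = #C + #L + 1 := by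
  have : (univ : Finset W) = insert c (C ∪ L) := by
    ext x
    simpa using hT.eq_root_or_mem x
  rw [← card_univ, this, card_insert_of_notMem, card_union_of_disjoint hT.disjoint]
  simp [hT.root_notMem_children, hT.root_notMem_leaves]

lemma IsDepthTwoTree.contains {W V : Type*} [Fintype W] {T : SimpleGraph W} {c : W}
    {C L : Finset W} {π : W → W} (hT : IsDepthTwoTree T c C L π) {G : SimpleGraph V} (v : V)
    (g h : W → V) (hg : ∀ x ∈ C, G.Adj v (g x)) (hg_inj : Set.InjOn g C)
    (hh : ∀ x ∈ L, G.Adj (g (π x)) (h x)) (hh_inj : Set.InjOn h L) (hhv : ∀ x ∈ L, h x ≠ v)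
    (hhg : ∀ x ∈ L, ∀ y ∈ C, h x ≠ g y) : Contains G T := by
  let f : W → V := fun x => if x ∈ C then g x else if x ∈ L then h x else v
  have fC : ∀ x ∈ C, f x = g x := fun x hx => by simp [f, hx]
  have fL : ∀ x ∈ L, f x = h x := fun x hx => by
    simp [f, hx, Finset.disjoint_right.1 hT.disjoint hx]
  have fc : f c = v := by simp [f, hT.root_notMem_children, hT.root_notMem_leaves]
  have hgv : ∀ x ∈ C, g x ≠ v := fun x hx => (hg x hx).ne'
  refine ⟨⟨f, ?_⟩, ?_⟩
  · intro x y hxy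
    rcases hT.adj x y hxy with ⟨rfl, hy⟩ | ⟨rfl, hx⟩ | ⟨hx, rfl⟩ | ⟨hy, rfl⟩
    · rw [fc, fC y hy]
      exact hg y hy
    · rw [fc, fC x hx]
      exact (hg x hx).symm
    · rw [fL x hx, fC _ (hT.parent_mem x hx)]
      exact (hh x hx).symm
    · rw [fL y hy, fC _ (hT.parent_mem y hy)]
      exact hh y hy
  · intro x y hxy
    change f x = f y at hxy
    rcases hT.eq_root_or_mem x with rfl | hx | hx <;>
      rcases hT.eq_root_or_mem y with rfl | hy | hy
    · rfl
    · rw [fc, fC y hy] at hxy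
      exact absurd hxy.symm (hgv y hy)
    · rw [fc, fL y hy] at hxy
      exact absurd hxy.symm (hhv y hy)
    · rw [fc, fC x hx] at hxy
      exact absurd hxy (hgv x hx)
    · rw [fC x hx, fC y hy] at hxy
      exact hg_inj hx hy hxy
    · rw [fC x hx, fL y hy] at hxy
      exact absurd hxy.symm (hhg y hy x hx)
    · rw [fc, fL x hx] at hxy
      exact absurd hxy (hhv x hx)
    · rw [fL x hx, fC y hy] at hxy
      exact absurd hxy (hhg x hx y hy)
    · rw [fL x hx, fL y hy] at hxy
      exact hh_inj hx hy hxy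

/-- Hall's theorem for a family indexed by a finset. -/
lemma exists_injOn_of_card_le_card_biUnion {W V : Type*} [Nonempty V] (L : Finset W)
    (t : W → Finset V) (ht : ∀ S ⊆ L, S.Nonempty → #S ≤ #(S.biUnion t)) :
    ∃ h : W → V, Set.InjOn h L ∧ ∀ x ∈ L, h x ∈ t x := by
  have key := (Finset.all_card_le_biUnion_card_iff_exists_injective
    (fun x : L => t x)).1 (by
      intro S
      rcases S.eq_empty_or_nonempty with rfl | hS
      · simp
      · have h := ht (S.map (Function.Embedding.subtype _)) (by
          intro x hx
          obtain ⟨y, -, rfl⟩ := Finset.mem_map.1 hx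
          exact y.2) (hS.map)
        rw [card_map] at h
        refine h.trans (card_le_card ?_)
        intro x hx
        simp only [mem_biUnion, mem_map, Function.Embedding.coe_subtype] at hx ⊢
        obtain ⟨_, ⟨y, hy, rfl⟩, hxy⟩ := hx
        exact ⟨y, hy, hxy⟩)
  obtain ⟨f, hf, hft⟩ := key
  refine ⟨fun x => if hx : x ∈ L then f ⟨x, hx⟩ else Classical.arbitrary V, ?_, ?_⟩
  · intro x hx y hy hxy
    have hx' : x ∈ L := hx
    have hy' : y ∈ L := hy
    simp only [hx', hy', dif_pos] at hxy
    simpa using hf hxy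
  · intro x hx
    simp only [hx, dif_pos]
    exact hft ⟨x, hx⟩

lemma exists_injOn_of_card_le {W V : Type*} [Nonempty V] (S : Finset W) (A : Finset V)
    (hSA : #S ≤ #A) : ∃ h : W → V, Set.InjOn h S ∧ ∀ x ∈ S, h x ∈ A := by
  refine exists_injOn_of_card_le_card_biUnion S (fun _ => A) fun S' hS' hne => ?_
  obtain ⟨x, hx⟩ := hne
  exact (card_le_card hS').trans (hSA.trans (card_le_card (subset_biUnion_of_mem (fun _ => A) hx)))

/-- An injection of `P ⊆ C` into `A` extends to `C` if `A` is large enough. -/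
lemma exists_injOn_extend {W V : Type*} [Nonempty V] {P C : Finset W} (hPC : P ⊆ C)
    {A : Finset V} (g₀ : W → V) (hg₀ : Set.InjOn g₀ P) (hA : ∀ x ∈ P, g₀ x ∈ A)
    (hcard : #C ≤ #A) :
    ∃ g : W → V, Set.InjOn g C ∧ (∀ x ∈ P, g x = g₀ x) ∧ ∀ x ∈ C, g x ∈ A := by
  have him : P.image g₀ ⊆ A := by
    intro y hy
    obtain ⟨x, hx, rfl⟩ := Finset.mem_image.1 hy
    exact hA x hx
  obtain ⟨h, hh, hhA⟩ := exists_injOn_of_card_le (C \ P) (A \ P.image g₀) (by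
    rw [card_sdiff_of_subset hPC, card_sdiff_of_subset him, card_image_of_injOn hg₀]
    omega)
  have hne : ∀ x ∈ C, x ∉ P → h x ∈ A ∧ ∀ y ∈ P, g₀ y ≠ h x := by
    intro x hx hxP
    have := hhA x (mem_sdiff.2 ⟨hx, hxP⟩)
    simpa using this
  refine ⟨fun x => if x ∈ P then g₀ x else h x, ?_, ?_, ?_⟩
  · intro x hx y hy hxy
    have hx' : x ∈ C := hx
    have hy' : y ∈ C := hy
    by_cases hxP : x ∈ P <;> by_cases hyP : y ∈ P <;> simp only [hxP, hyP, if_true, if_false] at hxy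
    · exact hg₀ hxP hyP hxy
    · exact absurd hxy ((hne y hy' hyP).2 x hxP)
    · exact absurd hxy.symm ((hne x hx' hxP).2 y hyP)
    · exact hh (by simp [hx', hxP]) (by simp [hy', hyP]) hxy
  · intro x hx
    simp [hx]
  · intro x hx
    by_cases hxP : x ∈ P
    · simpa [hxP] using hA x hxP
    · simpa [hxP] using (hne x hx hxP).1

section Embedding

variable {W V : Type*} [Fintype W] [Fintype V] {T : SimpleGraph W} {c : W} {C L : Finset W}
  {π : W → W} {G : SimpleGraph V}

/-- A vertex with enough neighbours of large degree can serve as the root of a copy of the tree. -/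
lemma IsDepthTwoTree.contains_of_large_neighbors (hT : IsDepthTwoTree T c C L π) (v : V)
    (hv : #C ≤ G.degree v)
    (hbig : #(L.image π) ≤ #((G.neighborFinset v).filter fun u => #C + #L ≤ G.degree u)) :
    Contains G T := by
  have : Nonempty V := ⟨v⟩
  obtain ⟨g₀, hg₀, hg₀U⟩ := exists_injOn_of_card_le _ _ hbig
  have hPC : L.image π ⊆ C := by
    intro y hy
    obtain ⟨x, hx, rfl⟩ := Finset.mem_image.1 hy
    exact hT.parent_mem x hx
  obtain ⟨g, hg, hgg₀, hgA⟩ := exists_injOn_extend hPC (A := G.neighborFinset v) g₀ hg₀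
    (fun x hx => (mem_filter.1 (hg₀U x hx)).1) (by rwa [card_neighborFinset_eq_degree])
  have hdeg : ∀ x ∈ L, #L ≤ #(G.neighborFinset (g (π x)) \ insert v (C.image g)) := by
    intro x hx
    have hxP : π x ∈ L.image π := mem_image_of_mem π hx
    have hbigx : #C + #L ≤ G.degree (g (π x)) := by
      rw [hgg₀ _ hxP]
      exact (mem_filter.1 (hg₀U _ hxP)).2
    have hsub : G.neighborFinset (g (π x)) \ insert v ((C.image g).erase (g (π x))) ⊆
        G.neighborFinset (g (π x)) \ insert v (C.image g) := by
      intro y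
      simp only [mem_sdiff, mem_neighborFinset, mem_insert, mem_erase, not_or, not_and]
      rintro ⟨h1, h2, h3⟩
      exact ⟨h1, h2, h3 h1.ne'⟩
    have h1 := card_le_card hsub
    have h2 := le_card_sdiff (insert v ((C.image g).erase (g (π x))))
      (G.neighborFinset (g (π x)))
    have h3 := card_insert_le v ((C.image g).erase (g (π x)))
    have h4 : #((C.image g).erase (g (π x))) + 1 = #(C.image g) :=
      card_erase_add_one (mem_image_of_mem g (hT.parent_mem x hx))
    have h5 := card_image_le (s := C) (f := g)
    rw [card_neighborFinset_eq_degree] at h2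
    omega
  obtain ⟨h, hh, hht⟩ := exists_injOn_of_card_le_card_biUnion L
    (fun x => G.neighborFinset (g (π x)) \ insert v (C.image g)) (by
      rintro S hS ⟨x, hx⟩
      exact (card_le_card hS).trans ((hdeg x (hS hx)).trans
        (card_le_card (subset_biUnion_of_mem
          (fun x => G.neighborFinset (g (π x)) \ insert v (C.image g)) hx))))
  simp only [mem_sdiff, mem_neighborFinset, mem_insert, not_or, Finset.mem_image, not_exists,
    not_and] at hht
  exact hT.contains v g h (fun x hx => (mem_neighborFinset _ _ _).1 (hgA x hx)) hg
    (fun x hx => (hht x hx).1) hh (fun x hx => (hht x hx).2.1)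
    (fun x hx y hy => Ne.symm ((hht x hx).2.2 y hy))

/-- A vertex `v` of large degree is the root of a copy of the tree, if its neighbourhood contains
an ordered set `U` in which each vertex of small degree has few small earlier neighbours. -/
lemma IsDepthTwoTree.contains_of_ordered_neighbors (hT : IsDepthTwoTree T c C L π) (v : V)
    (hv : #C + #L ≤ G.degree v) (U : Finset V) (hU : U ⊆ G.neighborFinset v)
    (hUcard : #U = #(L.image π)) (ρ : V → ℕ) (hρ : Set.InjOn ρ U)
    (hsmall : ∀ u ∈ U, G.degree u < #C + #L →
      #L + 1 + #(U.filter fun w => ρ w < ρ u ∧ G.degree w < #C + #L ∧ G.Adj w u) ≤ G.degree u) :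
    Contains G T := by
  have : Nonempty V := ⟨v⟩
  have hPC : L.image π ⊆ C := by
    intro y hy
    obtain ⟨x, hx, rfl⟩ := Finset.mem_image.1 hy
    exact hT.parent_mem x hx
  obtain ⟨g₀, hg₀, hg₀U⟩ := exists_injOn_of_card_le (L.image π) U hUcard.ge
  have himg : (L.image π).image g₀ = U := by
    apply eq_of_subset_of_card_le
    · intro y hy
      obtain ⟨x, hx, rfl⟩ := Finset.mem_image.1 hy
      exact hg₀U x hx
    · rw [card_image_of_injOn hg₀, hUcard]
  have hLU : ∀ x ∈ L, g₀ (π x) ∈ U := fun x hx => hg₀U _ (mem_image_of_mem π hx)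
  let t : W → Finset V := fun x => G.neighborFinset (g₀ (π x)) \ insert v U
  have ht : ∀ x ∈ L, G.degree (g₀ (π x)) ≤ #(t x) + 1 + #(U.filter fun w => G.Adj w (g₀ (π x))) := by
    intro x hx
    have hsub : G.neighborFinset (g₀ (π x)) ⊆
        t x ∪ insert v (U.filter fun w => G.Adj w (g₀ (π x))) := by
      intro y hy
      have hy' : G.Adj (g₀ (π x)) y := (mem_neighborFinset _ _ _).1 hy
      simp only [t, mem_union, mem_sdiff, mem_neighborFinset, mem_insert, mem_filter]
      have := hy'.symm
      tauto
    have h1 := card_le_card hsub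
    have h2 := card_union_le (t x) (insert v (U.filter fun w => G.Adj w (g₀ (π x))))
    have h3 := card_insert_le v (U.filter fun w => G.Adj w (g₀ (π x)))
    rw [card_neighborFinset_eq_degree] at h1
    omega
  obtain ⟨h, hh, hht⟩ := exists_injOn_of_card_le_card_biUnion L t (by
    intro S hS hne
    suffices ∃ x ∈ S, #S ≤ #(t x) by
      obtain ⟨x, hx, hle⟩ := this
      exact hle.trans (card_le_card (subset_biUnion_of_mem t hx))
    by_cases hb : ∃ x ∈ S, #C + #L ≤ G.degree (g₀ (π x))
    · obtain ⟨x, hx, hdx⟩ := hb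
      refine ⟨x, hx, ?_⟩
      have h1 := ht x (hS hx)
      have h2 : (U.filter fun w => G.Adj w (g₀ (π x))) ⊆ U.erase (g₀ (π x)) := by
        intro w hw
        obtain ⟨hwU, hw⟩ := mem_filter.1 hw
        exact mem_erase.2 ⟨hw.ne, hwU⟩
      have h3 := card_le_card h2
      have h4 := card_erase_add_one (hLU x (hS hx))
      have h5 := card_le_card hPC
      have h6 := card_le_card hS
      omega
    · push Not at hb
      obtain ⟨x, hx, hmax⟩ := S.exists_max_image (fun x => ρ (g₀ (π x))) hne
      refine ⟨x, hx, ?_⟩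
      have h1 := ht x (hS hx)
      have h2 := hsmall _ (hLU x (hS hx)) (hb x hx)
      set u := g₀ (π x) with hu
      let Q := U.filter fun w => ρ w < ρ u ∧ G.degree w < #C + #L ∧ G.Adj w u
      let R := U.filter fun w => ¬(ρ w < ρ u ∧ G.degree w < #C + #L) ∧ G.Adj w u
      have h3 : #(U.filter fun w => G.Adj w u) ≤ #Q + #R := by
        refine (card_le_card ?_).trans (card_union_le Q R)
        intro w
        simp only [Q, R, mem_union, mem_filter]
        tauto
      have h4 : R ⊆ (L \ S).image (fun y => g₀ (π y)) := by
        intro w hw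
        obtain ⟨hwU, hw1, hw2⟩ := mem_filter.1 hw
        rw [← himg, Finset.mem_image] at hwU
        obtain ⟨z, hz, rfl⟩ := hwU
        obtain ⟨y, hy, rfl⟩ := Finset.mem_image.1 hz
        refine Finset.mem_image.2 ⟨y, mem_sdiff.2 ⟨hy, fun hyS => ?_⟩, rfl⟩
        apply hw1
        refine ⟨lt_of_le_of_ne (hmax y hyS) fun he => ?_, hb y hyS⟩
        exact hw2.ne (hρ (hLU y hy) (hLU x (hS hx)) he)
      have h5 := (card_le_card h4).trans card_image_le
      rw [card_sdiff_of_subset hS] at h5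
      have h6 := card_le_card hS
      change #L + 1 + #Q ≤ _ at h2
      omega)
  simp only [t, mem_sdiff, mem_neighborFinset, mem_insert, not_or] at hht
  obtain ⟨g, hg, hgg₀, hgA⟩ := exists_injOn_extend hPC (A := G.neighborFinset v \ L.image h) g₀ hg₀
    (by
      intro x hx
      refine mem_sdiff.2 ⟨hU (hg₀U x hx), fun hmem => ?_⟩
      obtain ⟨y, hy, he⟩ := Finset.mem_image.1 hmem
      exact (hht y hy).2.2 (he ▸ hg₀U x hx))
    (by
      have h1 := le_card_sdiff (L.image h) (G.neighborFinset v)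
      have h2 := card_image_le (s := L) (f := h)
      rw [card_neighborFinset_eq_degree] at h1
      omega)
  simp only [mem_sdiff, mem_neighborFinset, Finset.mem_image, not_exists, not_and] at hgA
  refine hT.contains v g h (fun x hx => (hgA x hx).1) hg (fun x hx => ?_) hh
    (fun x hx => (hht x hx).2.1) (fun x hx y hy => (hgA y hy).2 x hx)
  rw [hgg₀ _ (mem_image_of_mem π hx)]
  exact (hht x hx).1

end Embedding

/-- If the weights `F` on `N` are small on average, and vertices of large weight have few
`R`-neighbours, then `N` contains an ordered `m`-set in which the weight of each vertex plus the
number of its earlier `R`-neighbours is small. -/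
lemma exists_ordered_subset {V : Type*} (R : V → V → Prop) [DecidableRel R]
    (hR : ∀ x y, R x y → R y x) (M : ℤ) (m : ℕ) : ∀ (p : ℕ) (N : Finset V) (F : V → ℤ),
    (∀ u ∈ N, 0 ≤ F u) →
    (∀ u ∈ N, (#(N.filter fun w => R u w) : ℤ) + M + F u ≤ #N - 1 + p) →
    (∑ u ∈ N, F u < (m - 1) * M + p * #N) →
    (M + 2 * m + p - 1 ≤ #N) →
    ∃ U ⊆ N, #U = m ∧ ∃ ρ : V → ℕ, Set.InjOn ρ U ∧
      ∀ u ∈ U, F u + #(U.filter fun w => ρ w < ρ u ∧ R w u) ≤ p + m - 2 := by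
  induction m with
  | zero =>
    intro p N F _ _ _ _
    exact ⟨∅, by simp, by simp, fun _ => 0, by simp, by simp⟩
  | succ m ih =>
    intro p N F h0 h1 h2 h3
    push_cast at h2 h3
    by_cases hcand : ∃ u ∈ N, (p : ℤ) ≤ F u ∧ F u ≤ p + m - 1
    · obtain ⟨u, hu, hu1, hu2⟩ := hcand
      have hcard : (#(N.erase u) : ℤ) = #N - 1 := by
        have := card_erase_add_one hu
        omega
      obtain ⟨U, hUN, hUm, ρ, hρ, hUF⟩ := ih (p + 1) (N.erase u)
        (fun w => F w + if R u w then 1 else 0)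
        (by
          intro w hw
          have := h0 w (mem_of_mem_erase hw)
          split_ifs <;> omega)
        (by
          intro w hw
          have := h1 w (mem_of_mem_erase hw)
          rw [hcard]
          by_cases hr : R u w
          · have he : ((N.erase u).filter fun x => R w x) = (N.filter fun x => R w x).erase u := by
              ext x
              simp only [mem_filter, mem_erase]
              tauto
            have := card_erase_add_one (s := N.filter fun x => R w x) (a := u)
              (mem_filter.2 ⟨hu, hR _ _ hr⟩)
            rw [he]
            simp only [hr, if_true]
            push_cast
            omega
          · have := card_le_card (filter_subset_filter (fun x => R w x) (erase_subset u N))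
            simp only [hr, if_false]
            push_cast
            omega)
        (by
          rw [sum_add_distrib, hcard, Finset.sum_boole]
          have e1 := Finset.add_sum_erase N F hu
          have e2 := h1 u hu
          have e3 := card_le_card (filter_subset_filter (fun x => R u x) (erase_subset u N))
          push_cast
          have e4 : (#((N.erase u).filter fun x => R u x) : ℤ) ≤ #(N.filter fun x => R u x) := by
            exact_mod_cast e3
          nlinarith)
        (by rw [hcard]; push_cast; linarith)
      have huU : u ∉ U := fun h => (mem_erase.1 (hUN h)).1 rfl
      refine ⟨insert u U, ?_, by rw [card_insert_of_notMem huU, hUm],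
        fun w => if w = u then 0 else ρ w + 1, ?_, ?_⟩
      · exact insert_subset hu (hUN.trans (erase_subset u N))
      · intro x hx y hy hxy
        rw [coe_insert] at hx hy
        by_cases hxu : x = u <;> by_cases hyu : y = u <;> simp only [hxu, hyu, if_true, if_false] at hxy
        · rw [hxu, hyu]
        · omega
        · omega
        · exact hρ (hx.resolve_left hxu) (hy.resolve_left hyu) (by omega)
      · intro w hw
        rcases mem_insert.1 hw with rfl | hwU
        · simp only [if_true, not_lt_zero, false_and, filter_false, card_empty]
          push_cast
          linarith
        · have hwu : w ≠ u := fun h => huU (h ▸ hwU)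
          have := hUF w hwU
          simp only [hwu, if_false]
          have hc : #((insert u U).filter fun x => (if x = u then 0 else ρ x + 1) < ρ w + 1 ∧ R x w)
              ≤ #(U.filter fun x => ρ x < ρ w ∧ R x w) + if R u w then 1 else 0 := by
            rw [filter_insert]
            have he : (U.filter fun x => (if x = u then 0 else ρ x + 1) < ρ w + 1 ∧ R x w) =
                U.filter fun x => ρ x < ρ w ∧ R x w := by
              apply filter_congr
              intro x hx
              have hxu : x ≠ u := fun h => huU (h ▸ hx)
              simp [hxu]
            rw [he]
            by_cases hr : R u w
            · simpa [hr] using card_insert_le u _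
            · simp [hr]
          have hc' : (#((insert u U).filter fun x =>
              (if x = u then 0 else ρ x + 1) < ρ w + 1 ∧ R x w) : ℤ)
              ≤ #(U.filter fun x => ρ x < ρ w ∧ R x w) + if R u w then 1 else 0 := by
            exact_mod_cast hc
          push_cast at this ⊢
          linarith
    · push Not at hcand
      let A := N.filter fun u => F u < p
      by_cases hA : m + 1 ≤ #A
      · obtain ⟨U, hUA, hUm⟩ := exists_subset_card_eq hA
        refine ⟨U, hUA.trans (filter_subset _ _), hUm, fun x => if hx : x ∈ U then U.equivFin ⟨x, hx⟩
          else 0, ?_, ?_⟩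
        · intro x hx y hy hxy
          have hx' : x ∈ U := hx
          have hy' : y ∈ U := hy
          simp only [hx', hy', dif_pos] at hxy
          have := U.equivFin.injective (Fin.ext hxy)
          simpa using this
        · intro u hu
          have hFu := (mem_filter.1 (hUA hu)).2
          have hlt : #(U.filter fun w => (if hx : w ∈ U then (U.equivFin ⟨w, hx⟩ : ℕ) else 0) <
              (if hx : u ∈ U then (U.equivFin ⟨u, hx⟩ : ℕ) else 0) ∧ R w u) < #U := by
            apply card_lt_card
            refine (ssubset_iff_of_subset (filter_subset _ _)).2 ⟨u, hu, ?_⟩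
            simp
          push_cast
          omega
      · exfalso
        have hsum : ((#N : ℤ) - #A) * (p + m) ≤ ∑ u ∈ N, F u := by
          rw [← sum_filter_add_sum_filter_not N (fun u => F u < p)]
          have s1 : 0 ≤ ∑ u ∈ N.filter (fun u => F u < p), F u :=
            sum_nonneg fun u hu => h0 u (mem_filter.1 hu).1
          have s2 : #(N.filter fun u => ¬ F u < p) • ((p : ℤ) + m) ≤
              ∑ u ∈ N.filter (fun u => ¬ F u < p), F u := by
            apply card_nsmul_le_sum
            intro u hu
            obtain ⟨hu, hF⟩ := mem_filter.1 hu
            have := hcand u hu (not_lt.1 hF)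
            omega
          have s3 := card_filter_add_card_filter_not (s := N) (fun u => F u < p)
          have s4 : ((#N : ℤ) - #A) = #(N.filter fun u => ¬ F u < p) := by
            rw [← s3]
            push_cast
            simp only [A]
            ring
          rw [s4]
          rw [nsmul_eq_mul] at s2
          linarith
        have hA' : (#A : ℤ) ≤ m := by omega
        have hp : (0 : ℤ) ≤ p := by positivity
        have hm : (0 : ℤ) ≤ m := by positivity
        nlinarith [mul_nonneg hm (show (0 : ℤ) ≤ #N - #A - M - p by linarith),
          mul_nonneg hp (sub_nonneg.2 hA')]

/-- Embedding under a minimum degree condition. -/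
lemma IsDepthTwoTree.contains_of_minDegree {W V : Type*} [Fintype W] [Fintype V]
    {T : SimpleGraph W} {c : W} {C L : Finset W} {π : W → W} (hT : IsDepthTwoTree T c C L π)
    {G : SimpleGraph V} (hmin : ∀ v, #C + #L ≤ 2 * G.degree v)
    (havg : (0 : ℤ) < ∑ v, ((G.degree v : ℤ) - (#C + #L - 1))) : Contains G T := by
  by_contra hG
  set s := #(L.image π) with hs
  have hsL : s ≤ #L := card_image_le
  have hsC : s ≤ #C := by
    refine card_le_card ?_
    intro y hy
    obtain ⟨x, hx, rfl⟩ := Finset.mem_image.1 hy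
    exact hT.parent_mem x hx
  let β : V → ℕ := fun u => #((G.neighborFinset u).filter fun w => #C + #L ≤ G.degree w)
  have hβ : ∀ u, #C ≤ G.degree u → β u < s := by
    intro u hu
    by_contra! h
    exact hG (hT.contains_of_large_neighbors u hu h)
  have hβdeg : ∀ u, β u ≤ G.degree u := fun u => by
    rw [← card_neighborFinset_eq_degree]
    exact card_filter_le _ _
  obtain ⟨v₀, -, hv₀⟩ : ∃ v ∈ (univ : Finset V), (0 : ℤ) < (G.degree v : ℤ) - (#C + #L - 1) := by
    by_contra! h
    exact absurd (sum_nonpos h) (not_le.2 havg)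
  have hs1 : 1 ≤ s := by
    have := hβ v₀ (by omega)
    omega
  let F : V → ℤ := fun u => max 0 ((s : ℤ) + #L - 1 - G.degree u)
  have hF0 : ∀ u, 0 ≤ F u := fun u => le_max_left _ _
  have hFbig : ∀ u, #C + #L ≤ G.degree u → F u = 0 := fun u hu => max_eq_left (by omega)
  have hFβ : ∀ u, ¬ #C + #L ≤ G.degree u →
      F u * β u ≤ ((s : ℤ) - 1) * (#C + #L - 1 - G.degree u) := by
    intro u hu
    have hmu := hmin u
    by_cases hCu : #C ≤ G.degree u
    · have h1 := hβ u hCu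
      have h2 : F u ≤ #C + #L - 1 - G.degree u := max_le (by omega) (by omega)
      rw [mul_comm]
      exact mul_le_mul (by omega) h2 (hF0 u) (by omega)
    · rcases le_total ((s : ℤ) + #L - 1 - G.degree u) 0 with h | h
      · have : F u = 0 := max_eq_left h
        rw [this, zero_mul]
        exact mul_nonneg (by omega) (by omega)
      · have hFu : F u = (s : ℤ) + #L - 1 - G.degree u := max_eq_right h
        rw [hFu]
        have h1 : ((s : ℤ) + #L - 1 - G.degree u) * β u ≤
            ((s : ℤ) + #L - 1 - G.degree u) * G.degree u :=
          mul_le_mul_of_nonneg_left (by exact_mod_cast hβdeg u) h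
        refine h1.trans ?_
        have a1 : (0 : ℤ) ≤ 2 * G.degree u - (#C + #L) + 1 := by omega
        have a2 : (0 : ℤ) ≤ G.degree u - s + 1 := by omega
        have a3 : (0 : ℤ) ≤ #C - G.degree u - 1 := by omega
        have a4 : (0 : ℤ) ≤ G.degree u := by omega
        nlinarith [mul_nonneg a1 a2, mul_nonneg a3 a4]
  by_cases hs2 : s = 1
  · have hpos : 0 < G.degree v₀ := by omega
    obtain ⟨w, hw⟩ := (G.degree_pos_iff_exists_adj v₀).1 hpos
    by_cases hCw : #C ≤ G.degree w
    · have h1 := hβ w hCw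
      have h2 : 0 < β w := card_pos.2 ⟨v₀, mem_filter.2
        ⟨(mem_neighborFinset _ _ _).2 hw.symm, by omega⟩⟩
      omega
    · refine hG (hT.contains_of_ordered_neighbors v₀ (by omega) {w} ?_ ?_ (fun _ => 0) ?_ ?_)
      · simpa using hw
      · rw [card_singleton]
        omega
      · simp
      · intro u hu _
        rw [mem_singleton] at hu
        subst hu
        have := hmin u
        simp only [lt_irrefl, false_and, filter_false, card_empty]
        omega
  have hs3 : (0 : ℤ) < s - 1 := by omega
  let B := univ.filter fun v : V => #C + #L ≤ G.degree v
  have hdouble : ∑ v ∈ B, ∑ u ∈ G.neighborFinset v, F u = ∑ u, F u * β u := by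
    have h1 : ∀ v : V, ∑ u ∈ G.neighborFinset v, F u = ∑ u, if G.Adj v u then F u else 0 := by
      intro v
      rw [← sum_filter]
      refine sum_congr ?_ fun _ _ => rfl
      ext u
      simp
    simp_rw [h1]
    rw [sum_comm]
    refine sum_congr rfl fun u _ => ?_
    rw [← sum_filter, sum_const, nsmul_eq_mul, mul_comm]
    congr 3
    ext w
    simp only [B, mem_filter, mem_univ, true_and, mem_neighborFinset]
    rw [and_comm, G.adj_comm]
  have hlt : ∑ v ∈ B, ∑ u ∈ G.neighborFinset v, F u <
      ∑ v ∈ B, ((s : ℤ) - 1) * (G.degree v - (#C + #L - 1)) := by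
    rw [hdouble, ← sum_filter_add_sum_filter_not univ (fun v : V => #C + #L ≤ G.degree v)]
    have h1 : ∑ u ∈ univ.filter (fun v : V => #C + #L ≤ G.degree v), F u * β u = 0 :=
      sum_eq_zero fun u hu => by rw [hFbig u (mem_filter.1 hu).2, zero_mul]
    have h2 : ∑ u ∈ univ.filter (fun v : V => ¬ #C + #L ≤ G.degree v), F u * β u ≤
        ∑ u ∈ univ.filter (fun v : V => ¬ #C + #L ≤ G.degree v),
          ((s : ℤ) - 1) * (#C + #L - 1 - G.degree u) :=
      sum_le_sum fun u hu => hFβ u (mem_filter.1 hu).2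
    rw [← mul_sum] at h2 ⊢
    rw [← sum_filter_add_sum_filter_not univ (fun v : V => #C + #L ≤ G.degree v)] at havg
    have h3 : ∑ u ∈ univ.filter (fun v : V => ¬ #C + #L ≤ G.degree v),
        ((#C : ℤ) + #L - 1 - G.degree u) =
        - ∑ u ∈ univ.filter (fun v : V => ¬ #C + #L ≤ G.degree v),
        ((G.degree u : ℤ) - (#C + #L - 1)) := by
      rw [← sum_neg_distrib]
      exact sum_congr rfl fun _ _ => by ring
    rw [h3] at h2
    rw [h1]
    simp only [B]
    nlinarith [mul_pos hs3 havg]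
  obtain ⟨v, hvB, hv⟩ := exists_lt_of_sum_lt hlt
  have hvD : #C + #L ≤ G.degree v := (mem_filter.1 hvB).2
  have hNcard : (#(G.neighborFinset v) : ℤ) = G.degree v := by
    rw [card_neighborFinset_eq_degree]
  obtain ⟨U, hUN, hUs, ρ, hρ, hU⟩ := exists_ordered_subset
    (fun x y => G.Adj x y ∧ G.degree x < #C + #L ∧ G.degree y < #C + #L)
    (fun x y h => ⟨h.1.symm, h.2.2, h.2.1⟩) ((G.degree v : ℤ) - (#C + #L - 1)) s 0
    (G.neighborFinset v) F (fun u _ => hF0 u)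
    (by
      intro u hu
      rw [mem_neighborFinset] at hu
      rw [hNcard]
      by_cases hub : #C + #L ≤ G.degree u
      · rw [hFbig u hub]
        have : ((G.neighborFinset v).filter fun w =>
            G.Adj u w ∧ G.degree u < #C + #L ∧ G.degree w < #C + #L) = ∅ := by
          apply filter_false_of_mem
          intro w _ h
          omega
        rw [this, card_empty]
        push_cast
        omega
      · have h1 : F u ≤ #C + #L - 1 - G.degree u := max_le (by omega) (by omega)
        have h2 : ((G.neighborFinset v).filter fun w =>
            G.Adj u w ∧ G.degree u < #C + #L ∧ G.degree w < #C + #L) ⊆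
            (G.neighborFinset u).erase v := by
          intro w hw
          obtain ⟨hw1, hw2, -⟩ := mem_filter.1 hw
          rw [mem_neighborFinset] at hw1
          exact mem_erase.2 ⟨hw1.ne', (mem_neighborFinset _ _ _).2 hw2⟩
        have h3 := card_le_card h2
        have h4 := card_erase_add_one ((G.mem_neighborFinset u v).2 hu.symm)
        rw [card_neighborFinset_eq_degree] at h4
        push_cast
        omega)
    (by push_cast; linarith)
    (by rw [hNcard]; push_cast; omega)
  refine hG (hT.contains_of_ordered_neighbors v hvD U hUN hUs ρ hρ ?_)
  intro u hu hud
  have h1 := hU u hu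
  have h2 : (s : ℤ) + #L - 1 - G.degree u ≤ F u := le_max_right _ _
  have h3 : (U.filter fun w => ρ w < ρ u ∧ G.degree w < #C + #L ∧ G.Adj w u) =
      U.filter fun w => ρ w < ρ u ∧ G.Adj w u ∧ G.degree w < #C + #L ∧ G.degree u < #C + #L := by
    apply filter_congr
    intro w _
    tauto
  rw [h3]
  push_cast at h1
  omega

/-- A graph of large average degree contains every tree of depth two, by passing to a subgraph of
large minimum degree. -/
lemma IsDepthTwoTree.contains_of_card_edges {W : Type*} [Fintype W]
    {T : SimpleGraph W} {c : W} {C L : Finset W} {π : W → W} (hT : IsDepthTwoTree T c C L π)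
    (n : ℕ) : ∀ {V : Type*} [Fintype V] (G : SimpleGraph V), Fintype.card V = n →
    ((#C : ℤ) + #L - 1) * n < 2 * #G.edgeFinset → Contains G T := by
  induction n with
  | zero =>
    intro V _ G hn he
    have : IsEmpty V := Fintype.card_eq_zero_iff.1 hn
    have h := G.sum_degrees_eq_twice_card_edges
    simp only [univ_eq_empty, sum_empty] at h
    push_cast at he
    omega
  | succ n ih =>
    intro V _ G hn he
    by_cases hmin : ∀ v, #C + #L ≤ 2 * G.degree v
    · refine hT.contains_of_minDegree hmin ?_
      rw [sum_sub_distrib, sum_const, card_univ, hn, nsmul_eq_mul]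
      have h := G.sum_degrees_eq_twice_card_edges
      have h' : ∑ v, (G.degree v : ℤ) = 2 * #G.edgeFinset := by exact_mod_cast h
      rw [h']
      linarith
    · push Not at hmin
      obtain ⟨x, hx⟩ := hmin
      have h1 := G.card_edgeFinset_induce_compl_singleton x
      have h2 := G.card_edgeFinset_deleteIncidenceSet x
      have h3 : G.degree x ≤ #G.edgeFinset := by
        rw [← card_incidenceFinset_eq_degree]
        exact card_le_card (G.incidenceFinset_subset x)
      obtain ⟨f, hf⟩ := ih (G.induce {x}ᶜ) (by
        rw [Fintype.card_compl_set, hn, Set.card_singleton]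
        rfl) (by
        have h4 : ((#C : ℤ) + #L - 1) * n < 2 * (#G.edgeFinset - G.degree x : ℕ) := by
          push_cast [h3] at he ⊢
          have : 2 * (G.degree x : ℤ) ≤ #C + #L - 1 := by omega
          linarith
        rw [← h2, ← h1] at h4
        convert h4)
      exact ⟨(Embedding.induce {x}ᶜ).toHom.comp f, Subtype.val_injective.comp hf⟩

theorem stmt_11 (k : ℕ) (hk : 2 ≤ k) {V : Type*} [Fintype V] (G : SimpleGraph V)
    (he : ((k : ℝ) - 2) * (Fintype.card V : ℝ) / 2 < (ecount G : ℝ))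
    {W : Type*} [Fintype W] (T : SimpleGraph W) (hT : T.IsTree)
    (hcard : Fintype.card W = k) (hdiam : ∀ v w : W, T.dist v w ≤ 4) :
    Contains G T := by
  obtain ⟨c, C, L, π, hS⟩ := hT.exists_isDepthTwoTree hdiam
  refine hS.contains_of_card_edges _ G rfl ?_
  have hk' : (k : ℝ) = #C + #L + 1 := by
    rw [← hcard, hS.card_eq]
    push_cast
    rfl
  have he' : ((#C : ℝ) + #L - 1) * Fintype.card V < 2 * #G.edgeFinset := by
    rw [hk'] at he
    unfold ecount at he
    linarith
  exact_mod_cast he'
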